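/- Let R be a commutative ring, let G be a finite group acting on a finite set B such that every element of G acts on B as a product of cycles of odd length (equivalently, for every h ∈ G every orbit of ⟨h⟩ on B has odd cardinality), and let A be the free R-module on B with the induced permutation action of G. Then for every n ≥ 0 the exterior power Λⁿ(A) has an R-basis which is permuted by G; in particular Λⁿ(A) is a permutation module. -/

import Mathlib

/-- The linear map `Λⁿ(f) : Λⁿ(M) → Λⁿ(N)` induced by a linear map `f : M → N`. -/
noncomputable def extMap (R : Type) [CommRing R] {M N : Type} [AddCommGroup M]
    [Module R M] [AddCommGroup N] [Module R N] (n : ℕ) (f : M →ₗ[R] N) :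
    ⋀[R]^n M →ₗ[R] ⋀[R]^n N :=
  (ExteriorAlgebra.map f).toLinearMap.restrict (fun x hx => by
    have h : Submodule.map (ExteriorAlgebra.map f).toLinearMap (⋀[R]^n M)
        ≤ ⋀[R]^n N := by
      rw [← ExteriorAlgebra.ιMulti_span_fixedDegree, ← ExteriorAlgebra.ιMulti_span_fixedDegree,
        Submodule.map_span, Submodule.span_le]
      rintro y ⟨_, ⟨v, rfl⟩, rfl⟩
      exact Submodule.subset_span ⟨f ∘ v, (ExteriorAlgebra.map_apply_ιMulti f v).symm⟩
    exact h ⟨x, hx, rfl⟩)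

/-- The wedge of the basis vectors indexed by `v`. -/
noncomputable def wedgeOf (R : Type) [CommRing R] {B : Type} (n : ℕ) (v : Fin n → B) :
    ⋀[R]^n (B →₀ R) :=
  exteriorPower.ιMulti R n (fun i => Finsupp.single (v i) (1 : R))

theorem extMap_wedgeOf (R : Type) [CommRing R] {B : Type} (n : ℕ) (v : Fin n → B) (f : B → B) :
    extMap R n (Finsupp.lmapDomain R R f) (wedgeOf R n v) = wedgeOf R n (fun i => f (v i)) := by
  apply Subtype.ext
  refine (ExteriorAlgebra.map_apply_ιMulti (Finsupp.lmapDomain R R f) _).trans ?_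
  simp only [wedgeOf, exteriorPower.ιMulti_apply_coe]
  congr 1
  funext i
  simp [Finsupp.mapDomain_single]

theorem wedgeOf_perm (R : Type) [CommRing R] {B : Type} (n : ℕ) (v : Fin n → B)
    (σ : Equiv.Perm (Fin n)) :
    wedgeOf R n (fun i => v (σ i)) = Equiv.Perm.sign σ • wedgeOf R n v :=
  (exteriorPower.ιMulti R n).map_perm (fun i => Finsupp.single (v i) (1 : R)) σ

theorem exists_perm_of_range {B : Type} (n : ℕ) (u v : Fin n → B)
    (hu : Function.Injective u) (hv : Function.Injective v) (h : Set.range u = Set.range v) :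
    ∃ σ : Equiv.Perm (Fin n), ∀ i, u i = v (σ i) := by
  refine ⟨(Equiv.ofInjective u hu).trans ((Equiv.setCongr h).trans (Equiv.ofInjective v hv).symm),
    fun i => ?_⟩
  simp [Equiv.apply_ofInjective_symm]

theorem exists_odd_pow {G B : Type} [Group G] [Fintype B] [MulAction G B] (h : G)
    (hodd : ∀ x : B, Odd (Nat.card (MulAction.orbit (Subgroup.zpowers h) x))) :
    ∃ m : ℕ, Odd m ∧ ∀ x : B, h ^ m • x = x := by
  classical
  refine ⟨∏ x : B, Function.minimalPeriod (h • ·) x, ?_, fun x => ?_⟩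
  · refine Finset.prod_induction _ Odd (fun _ _ => Odd.mul) odd_one fun x _ => ?_
    have hx := hodd x
    haveI : Fintype (MulAction.orbit (Subgroup.zpowers h) x) := Fintype.ofFinite _
    rwa [Nat.card_eq_fintype_card, ← MulAction.minimalPeriod_eq_card] at hx
  · rw [MulAction.pow_smul_eq_iff_minimalPeriod_dvd]
    exact Finset.dvd_prod_of_mem _ (Finset.mem_univ x)

theorem wedgeOf_stable (R : Type) [CommRing R] {G B : Type} [Group G] [Fintype B] [MulAction G B]
    (h : G) (hodd : ∀ x : B, Odd (Nat.card (MulAction.orbit (Subgroup.zpowers h) x)))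
    (n : ℕ) (v : Fin n → B) (hv : Function.Injective v)
    (hr : Set.range (fun i => h • v i) = Set.range v) :
    wedgeOf R n (fun i => h • v i) = wedgeOf R n v := by
  obtain ⟨σ, hσ⟩ := exists_perm_of_range n (fun i => h • v i) v
    ((MulAction.injective h).comp hv) hv hr
  obtain ⟨m, hm, hfix⟩ := exists_odd_pow h hodd
  have key : ∀ k : ℕ, ∀ i, h ^ k • v i = v ((σ ^ k) i) := by
    intro k
    induction k with
    | zero => simp
    | succ k ih =>
      intro i
      rw [pow_succ, mul_smul, hσ i, ih, pow_succ, Equiv.Perm.mul_apply]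
  have hone : σ ^ m = 1 := by
    ext i
    have := key m i
    rw [hfix] at this
    simp [← hv this]
  have hs : Equiv.Perm.sign σ = 1 := by
    have h1 : Equiv.Perm.sign σ ^ m = 1 := by rw [← map_pow, hone, map_one]
    rcases Int.units_eq_one_or (Equiv.Perm.sign σ) with h2 | h2
    · exact h2
    · rw [h2, hm.neg_one_pow] at h1
      exact absurd h1 (by decide)
  have : (fun i => h • v i) = fun i => v (σ i) := funext hσ
  rw [this, wedgeOf_perm, hs, one_smul]

/-- **Statement 5.** If a finite group `G` acts on a finite set `B` with every element
of `G` acting as a product of cycles of odd length (i.e. all `⟨h⟩`-orbits on `B` have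
odd cardinality), and `A` is the free `R`-module on `B` with the permutation action,
then every exterior power `Λⁿ(A)` has an `R`-basis permuted by `G`; in particular
`Λⁿ(A)` is a permutation module. -/
theorem exterior_power_of_odd_permutation_module
    (R : Type) [CommRing R] (G : Type) [Group G] [Finite G]
    (B : Type) [Fintype B] [MulAction G B]
    (hodd : ∀ (h : G) (x : B), Odd (Nat.card (MulAction.orbit (Subgroup.zpowers h) x)))
    (n : ℕ) :
    ∃ (ι : Type) (b : Module.Basis ι R (⋀[R]^n (B →₀ R))),
      ∀ (g : G) (i : ι), ∃ j : ι,
        extMap R n (Finsupp.lmapDomain R R (fun x : B => g • x)) (b i) = b j := by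
  classical
  letI : LinearOrder B := LinearOrder.lift' (Fintype.equivFin B) (Fintype.equivFin B).injective
  let e : Set.powersetCard B n → Fin n → B := fun s => Set.powersetCard.ofFinEmbEquiv.symm s
  have he : ∀ s, Function.Injective (e s) := fun s =>
    (Set.powersetCard.ofFinEmbEquiv.symm s).injective
  have hre : ∀ s, Set.range (e s) = ((s : Finset B) : Set B) := fun s => by
    ext x
    exact Set.powersetCard.mem_range_ofFinEmbEquiv_symm_iff_mem s x
  have hrg : ∀ (g : G) s, Set.range (fun i => g • e s i) = Set.range (e (g • s)) := fun g s => by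
    rw [hre, Set.powersetCard.coe_smul, Finset.coe_smul_finset, ← hre]
    ext x
    simp [Set.mem_smul_set]
  let r : Set.powersetCard B n → Set.powersetCard B n := fun s =>
    (Quotient.mk (MulAction.orbitRel G (Set.powersetCard B n)) s).out
  have hr : ∀ (g : G) s, r (g • s) = r s := fun g s => by
    have : Quotient.mk (MulAction.orbitRel G (Set.powersetCard B n)) (g • s) = Quotient.mk _ s :=
      Quotient.sound ⟨g, rfl⟩
    simp only [r, this]
  have hγ : ∀ s, ∃ g : G, g • r s = s := fun s => by
    have : (MulAction.orbitRel G (Set.powersetCard B n)) s (r s) := 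
      (MulAction.orbitRel G (Set.powersetCard B n)).symm (Quotient.mk_out (s := MulAction.orbitRel G _) s)
    exact this
  choose γ hγ using hγ
  have hσ : ∀ s, ∃ σ : Equiv.Perm (Fin n), ∀ i, γ s • e (r s) i = e s (σ i) := fun s =>
    exists_perm_of_range n (fun i => γ s • e (r s) i) (e s)
      ((MulAction.injective (γ s)).comp (he _)) (he s) (by rw [hrg, hγ])
  choose σ hσ using hσ
  let b₀ : Module.Basis (Set.powersetCard B n) R (⋀[R]^n (B →₀ R)) :=
    (Finsupp.basisSingleOne (R := R) (ι := B)).exteriorPower n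
  have hb₀ : ∀ s, b₀ s = wedgeOf R n (e s) := fun s => by
    simp only [b₀, exteriorPower.basis_apply, exteriorPower.ιMulti_family, wedgeOf]
    congr 1
  let b := b₀.unitsSMul (fun s => Units.map (Int.castRingHom R).toMonoidHom
    (Equiv.Perm.sign (σ s)))
  have hb : ∀ s, b s = wedgeOf R n (fun i => γ s • e (r s) i) := fun s => by
    have : (fun i => γ s • e (r s) i) = fun i => e s (σ s i) := funext (hσ s)
    rw [this, wedgeOf_perm, Module.Basis.unitsSMul_apply, hb₀]
    rcases Int.units_eq_one_or (Equiv.Perm.sign (σ s)) with h2 | h2 <;> simp [h2, Units.smul_def]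
  refine ⟨_, b, fun g s => ⟨g • s, ?_⟩⟩
  rw [hb, hb, extMap_wedgeOf]
  have hst : ((γ (g • s))⁻¹ * g * γ s) • r s = r s := by
    rw [mul_smul, mul_smul, hγ, inv_smul_eq_iff, ← hr g s, hγ]
  have h1 := wedgeOf_stable R ((γ (g • s))⁻¹ * g * γ s) (hodd _) n (e (r s)) (he _)
    (by rw [hrg, hst])
  have h2 := congrArg (extMap R n (Finsupp.lmapDomain R R (fun x : B => γ (g • s) • x))) h1
  rw [extMap_wedgeOf, extMap_wedgeOf] at h2
  rw [hr, ← h2]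
  congr 1
  funext i
  simp [smul_smul, mul_assoc]
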